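/- Let Ω be a bounded strictly pseudoconvex domain in ℂⁿ with C^∞ boundary, and let δ(z) = dist(z, ∂Ω) denote the Euclidean distance to the boundary, which is C^∞ on V ∩ Ω̄ for some open neighborhood V of ∂Ω. Then for every integer m ≥ 2 there exist an open neighborhood V_m ⊂ V of ∂Ω, smooth real-valued functions a₂,…,a_m on V_m, and a constant C > 0 such that the function r = −δ + Σ_{k=2}^m a_k δ^k satisfies: r < 0 on V_m ∩ Ω, r = 0 and ∇r ≠ 0 on ∂Ω, and |det H(r)(z)| ≤ C · δ(z)^{m−1} for all z ∈ V_m ∩ Ω. -/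

import Mathlib

open Complex Metric

noncomputable section

/-- The Wirtinger derivative `∂f/∂z_j` of `f : ℂⁿ → ℂ` at `z`. -/
def wDz (n : ℕ) (j : Fin n) (f : EuclideanSpace ℂ (Fin n) → ℂ)
    (z : EuclideanSpace ℂ (Fin n)) : ℂ :=
  (fderiv ℝ f z (EuclideanSpace.single j 1)
    - Complex.I * fderiv ℝ f z (EuclideanSpace.single j Complex.I)) / 2

/-- The Wirtinger derivative `∂f/∂z̄_j` of `f : ℂⁿ → ℂ` at `z`. -/
def wDzBar (n : ℕ) (j : Fin n) (f : EuclideanSpace ℂ (Fin n) → ℂ)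
    (z : EuclideanSpace ℂ (Fin n)) : ℂ :=
  (fderiv ℝ f z (EuclideanSpace.single j 1)
    + Complex.I * fderiv ℝ f z (EuclideanSpace.single j Complex.I)) / 2

/-- The complex Hessian matrix `H(u)(z) = [∂²u/∂z_i∂z̄_j(z)]` of a real-valued `u`. -/
def cHess (n : ℕ) (u : EuclideanSpace ℂ (Fin n) → ℝ)
    (z : EuclideanSpace ℂ (Fin n)) : Matrix (Fin n) (Fin n) ℂ :=
  Matrix.of fun i j => wDz n i (fun w => wDzBar n j (fun v => ((u v : ℝ) : ℂ)) w) z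

/-- The Hermitian form `Σ_{i,j} H(u)(z)_{ij} w_i w̄_j`. -/
def cHessForm (n : ℕ) (u : EuclideanSpace ℂ (Fin n) → ℝ)
    (z : EuclideanSpace ℂ (Fin n)) (w : Fin n → ℂ) : ℂ :=
  ∑ i, ∑ j, cHess n u z i j * w i * (starRingEnd ℂ) (w j)

/-- The pairing `Σ_j (∂u/∂z_j)(z) w_j` of the complex gradient with a vector. -/
def cGradPair (n : ℕ) (u : EuclideanSpace ℂ (Fin n) → ℝ)
    (z : EuclideanSpace ℂ (Fin n)) (w : Fin n → ℂ) : ℂ :=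
  ∑ j, wDz n j (fun v => ((u v : ℝ) : ℂ)) z * w j

/-- `ρ` is a `C^k` defining function for `Ω`, defined on the open neighborhood `U` of `Ω̄`. -/
def IsDefiningFn (n : ℕ) (k : ℕ∞) (Ω U : Set (EuclideanSpace ℂ (Fin n)))
    (ρ : EuclideanSpace ℂ (Fin n) → ℝ) : Prop :=
  IsOpen U ∧ closure Ω ⊆ U ∧ ContDiffOn ℝ k ρ U ∧
    Ω = {z ∈ U | ρ z < 0} ∧ ∀ z ∈ frontier Ω, fderiv ℝ ρ z ≠ 0

/-- `Ω` is a bounded strictly pseudoconvex domain with `C^k` boundary. -/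
def IsStrictlyPseudoconvexDomain (n : ℕ) (k : ℕ∞)
    (Ω : Set (EuclideanSpace ℂ (Fin n))) : Prop :=
  IsOpen Ω ∧ Bornology.IsBounded Ω ∧
    ∃ U ρ, IsDefiningFn n k Ω U ρ ∧
      ∀ z ∈ frontier Ω, ∀ w : Fin n → ℂ, w ≠ 0 →
        cGradPair n ρ z w = 0 → 0 < (cHessForm n ρ z w).re

/-- The complex Jacobian matrix `φ'(z) = [∂φ_i/∂z_j(z)]` of `φ : ℂⁿ → ℂⁿ`. -/
def jacobian (n : ℕ) (φ : EuclideanSpace ℂ (Fin n) → EuclideanSpace ℂ (Fin n))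
    (z : EuclideanSpace ℂ (Fin n)) : Matrix (Fin n) (Fin n) ℂ :=
  Matrix.of fun i j => wDz n j (fun w => φ w i) z

/-- `φ` is a proper map from `Ω₁` to `Ω₂`. -/
def IsProperMapOn (n : ℕ) (φ : EuclideanSpace ℂ (Fin n) → EuclideanSpace ℂ (Fin n))
    (Ω₁ Ω₂ : Set (EuclideanSpace ℂ (Fin n))) : Prop :=
  Set.MapsTo φ Ω₁ Ω₂ ∧ ∀ K ⊆ Ω₂, IsCompact K → IsCompact {z ∈ Ω₁ | φ z ∈ K}


abbrev EC (n : ℕ) := EuclideanSpace ℂ (Fin n)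

theorem aux_wDz_contDiffOn {n : ℕ} {W : Set (EC n)} (hW : IsOpen W) {f : EC n → ℂ}
    (hf : ContDiffOn ℝ (⊤ : ℕ∞) f W) (j : Fin n) :
    ContDiffOn ℝ (⊤ : ℕ∞) (wDz n j f) W := by
  have h : ContDiffOn ℝ (⊤ : ℕ∞) (fderiv ℝ f) W := hf.fderiv_of_isOpen hW (by simp)
  unfold wDz
  exact ((h.clm_apply contDiffOn_const).sub
    (contDiffOn_const.mul (h.clm_apply contDiffOn_const))).div_const _

theorem aux_wDzBar_contDiffOn {n : ℕ} {W : Set (EC n)} (hW : IsOpen W) {f : EC n → ℂ}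
    (hf : ContDiffOn ℝ (⊤ : ℕ∞) f W) (j : Fin n) :
    ContDiffOn ℝ (⊤ : ℕ∞) (wDzBar n j f) W := by
  have h : ContDiffOn ℝ (⊤ : ℕ∞) (fderiv ℝ f) W := hf.fderiv_of_isOpen hW (by simp)
  unfold wDzBar
  exact ((h.clm_apply contDiffOn_const).add
    (contDiffOn_const.mul (h.clm_apply contDiffOn_const))).div_const _

theorem aux_diffAt {n : ℕ} {W : Set (EC n)} (hW : IsOpen W) {F : Type*} [NormedAddCommGroup F]
    [NormedSpace ℝ F] {f : EC n → F}
    (hf : ContDiffOn ℝ (⊤ : ℕ∞) f W) {z : EC n} (hz : z ∈ W) : DifferentiableAt ℝ f z :=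
  (hf.contDiffAt (hW.mem_nhds hz)).differentiableAt (by simp)

theorem aux_ofReal {n : ℕ} {W : Set (EC n)} {f : EC n → ℝ}
    (hf : ContDiffOn ℝ (⊤ : ℕ∞) f W) :
    ContDiffOn ℝ (⊤ : ℕ∞) (fun v => ((f v : ℝ) : ℂ)) W :=
  Complex.ofRealCLM.contDiff.comp_contDiffOn hf

theorem aux_re {n : ℕ} {W : Set (EC n)} {f : EC n → ℂ}
    (hf : ContDiffOn ℝ (⊤ : ℕ∞) f W) :
    ContDiffOn ℝ (⊤ : ℕ∞) (fun v => (f v).re) W :=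
  Complex.reCLM.contDiff.comp_contDiffOn hf

theorem aux_wDz_congr {n : ℕ} {W : Set (EC n)} (hW : IsOpen W) {f g : EC n → ℂ}
    (h : ∀ z ∈ W, f z = g z) (j : Fin n) {z : EC n} (hz : z ∈ W) :
    wDz n j f z = wDz n j g z := by
  have : f =ᶠ[nhds z] g := Filter.eventually_of_mem (hW.mem_nhds hz) h
  simp only [wDz, this.fderiv_eq]

theorem aux_wDz_add {n : ℕ} {f g : EC n → ℂ} (j : Fin n) {z : EC n}
    (hf : DifferentiableAt ℝ f z) (hg : DifferentiableAt ℝ g z) :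
    wDz n j (fun v => f v + g v) z = wDz n j f z + wDz n j g z := by
  simp only [wDz, fderiv_fun_add hf hg, add_apply]
  ring

theorem aux_wDzBar_add {n : ℕ} {f g : EC n → ℂ} (j : Fin n) {z : EC n}
    (hf : DifferentiableAt ℝ f z) (hg : DifferentiableAt ℝ g z) :
    wDzBar n j (fun v => f v + g v) z = wDzBar n j f z + wDzBar n j g z := by
  simp only [wDzBar, fderiv_fun_add hf hg, add_apply]
  ring

theorem aux_wDz_mul {n : ℕ} {f g : EC n → ℂ} (j : Fin n) {z : EC n}
    (hf : DifferentiableAt ℝ f z) (hg : DifferentiableAt ℝ g z) :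
    wDz n j (fun v => f v * g v) z = f z * wDz n j g z + wDz n j f z * g z := by
  simp only [wDz, fderiv_fun_mul hf hg, add_apply,
    smul_apply, smul_eq_mul]
  ring

theorem aux_wDzBar_mul {n : ℕ} {f g : EC n → ℂ} (j : Fin n) {z : EC n}
    (hf : DifferentiableAt ℝ f z) (hg : DifferentiableAt ℝ g z) :
    wDzBar n j (fun v => f v * g v) z = f z * wDzBar n j g z + wDzBar n j f z * g z := by
  simp only [wDzBar, fderiv_fun_mul hf hg, add_apply,
    smul_apply, smul_eq_mul]
  ring

theorem aux_wDz_pow {n : ℕ} {f : EC n → ℂ} (j : Fin n) {z : EC n}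
    (hf : DifferentiableAt ℝ f z) (k : ℕ) :
    wDz n j (fun v => f v ^ (k + 1)) z = (k + 1) * f z ^ k * wDz n j f z := by
  simp only [wDz, fderiv_fun_pow (k + 1) hf, smul_apply, smul_eq_mul, 
    nsmul_eq_mul]
  simp
  ring

theorem aux_wDzBar_pow {n : ℕ} {f : EC n → ℂ} (j : Fin n) {z : EC n}
    (hf : DifferentiableAt ℝ f z) (k : ℕ) :
    wDzBar n j (fun v => f v ^ (k + 1)) z = (k + 1) * f z ^ k * wDzBar n j f z := by
  simp only [wDzBar, fderiv_fun_pow (k + 1) hf, smul_apply, smul_eq_mul, 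
    nsmul_eq_mul]
  simp
  ring

theorem aux_wDz_const {n : ℕ} (c : ℂ) (j : Fin n) {z : EC n} :
    wDz n j (fun _ => c) z = 0 := by
  simp [wDz]

/-- Complex gradient data of `d`. -/
def cz (n : ℕ) (d : EC n → ℝ) (z : EC n) (i : Fin n) : ℂ := wDz n i (fun v => ((d v : ℝ) : ℂ)) z
def czb (n : ℕ) (d : EC n → ℝ) (z : EC n) (i : Fin n) : ℂ :=
  wDzBar n i (fun v => ((d v : ℝ) : ℂ)) z

theorem aux_cHess_step {n : ℕ} {W : Set (EC n)} (hW : IsOpen W) {d a r : EC n → ℝ}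
    (hd : ContDiffOn ℝ (⊤ : ℕ∞) d W) (ha : ContDiffOn ℝ (⊤ : ℕ∞) a W)
    (hr : ContDiffOn ℝ (⊤ : ℕ∞) r W) (k : ℕ) :
    ∃ B : EC n → Matrix (Fin n) (Fin n) ℂ,
      (∀ i j, ContDiffOn ℝ (⊤ : ℕ∞) (fun z => B z i j) W) ∧
      ∀ z ∈ W, cHess n (fun v => r v + a v * d v ^ (k + 2)) z =
        cHess n r z + (((k + 1 : ℝ) * (k + 2) * a z * d z ^ k : ℝ) : ℂ) •
          Matrix.vecMulVec (cz n d z) (czb n d z) + ((d z : ℂ) ^ (k + 1)) • B z := by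
  set A : EC n → ℂ := fun v => ((a v : ℝ) : ℂ) with hA
  set D : EC n → ℂ := fun v => ((d v : ℝ) : ℂ) with hD
  set R : EC n → ℂ := fun v => ((r v : ℝ) : ℂ) with hR
  have hAs : ContDiffOn ℝ (⊤ : ℕ∞) A W := aux_ofReal ha
  have hDs : ContDiffOn ℝ (⊤ : ℕ∞) D W := aux_ofReal hd
  have hRs : ContDiffOn ℝ (⊤ : ℕ∞) R W := aux_ofReal hr
  have hAb := aux_wDzBar_contDiffOn hW hAs
  have hDb := aux_wDzBar_contDiffOn hW hDs
  have hRb := aux_wDzBar_contDiffOn hW hRs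
  have hAz := aux_wDz_contDiffOn hW hAs
  have hDz := aux_wDz_contDiffOn hW hDs
  refine ⟨fun z => Matrix.of fun i j =>
    (k + 2) * (A z * wDz n i (wDzBar n j D) z + wDz n i A z * wDzBar n j D z
      + wDzBar n j A z * wDz n i D z) + D z * wDz n i (wDzBar n j A) z, ?_, ?_⟩
  · intro i j
    simp only [Matrix.of_apply]
    exact (contDiffOn_const.mul (((hAs.mul (aux_wDz_contDiffOn hW (hDb j) i)).add
      ((hAz i).mul (hDb j))).add ((hAb j).mul (hDz i)))).add
      (hDs.mul (aux_wDz_contDiffOn hW (hAb j) i))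
  · intro z hz
    ext i j
    have key : ∀ w ∈ W, wDzBar n j (fun v => ((r v + a v * d v ^ (k + 2) : ℝ) : ℂ)) w =
        wDzBar n j R w + (A w * ((k + 2) * (D w ^ (k + 1) * wDzBar n j D w)) +
          wDzBar n j A w * D w ^ (k + 2)) := by
      intro w hw
      have e : (fun v => ((r v + a v * d v ^ (k + 2) : ℝ) : ℂ)) =
          fun v => R v + A v * D v ^ (k + 2) := by
        funext v; simp [hA, hD, hR]
      have dR := aux_diffAt hW hRs hw
      have dA := aux_diffAt hW hAs hw
      have dD := aux_diffAt hW hDs hw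
      rw [e, aux_wDzBar_add j dR (dA.fun_mul (dD.fun_pow _)), aux_wDzBar_mul j dA (dD.fun_pow _),
        aux_wDzBar_pow j dD]
      push_cast
      ring
    have dR := aux_diffAt hW (hRb j) hz
    have dA := aux_diffAt hW hAs hz
    have dD := aux_diffAt hW hDs hz
    have dAb := aux_diffAt hW (hAb j) hz
    have dDb := aux_diffAt hW (hDb j) hz
    have dP1 : DifferentiableAt ℝ (fun w => D w ^ (k + 1)) z := dD.fun_pow _
    have dP2 : DifferentiableAt ℝ (fun w => D w ^ (k + 2)) z := dD.fun_pow _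
    have dX1 : DifferentiableAt ℝ (fun w => D w ^ (k + 1) * wDzBar n j D w) z := dP1.fun_mul dDb
    have dX2 : DifferentiableAt ℝ (fun w => ((k : ℂ) + 2) * (D w ^ (k + 1) * wDzBar n j D w)) z :=
      (differentiableAt_const _).fun_mul dX1
    have h1 : cHess n (fun v => r v + a v * d v ^ (k + 2)) z i j = _ :=
      aux_wDz_congr hW key i hz
    rw [h1, aux_wDz_add i dR ((dA.fun_mul dX2).fun_add (dAb.fun_mul dP2)),
      aux_wDz_add i (dA.fun_mul dX2) (dAb.fun_mul dP2), aux_wDz_mul i dA dX2,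
      aux_wDz_mul i (differentiableAt_const _) dX1, aux_wDz_mul i dP1 dDb,
      aux_wDz_mul i dAb dP2, aux_wDz_pow i dD, aux_wDz_pow i dD, aux_wDz_const]
    have h2 : cHess n r z i j = wDz n i (wDzBar n j R) z := rfl
    simp only [Matrix.add_apply, Matrix.smul_apply, Matrix.vecMulVec_apply, Matrix.of_apply,
      smul_eq_mul, h2, cz, czb]
    push_cast
    simp only [hA, hD, hR]
    ring

theorem aux_prod_expand {n : ℕ} {W : Set (EC n)} {ι : Type*} (S : Finset ι)
    {x b : ι → EC n → ℂ} {s : EC n → ℂ}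
    (hx : ∀ i, ContDiffOn ℝ (⊤ : ℕ∞) (x i) W) (hb : ∀ i, ContDiffOn ℝ (⊤ : ℕ∞) (b i) W)
    (hs : ContDiffOn ℝ (⊤ : ℕ∞) s W) :
    ∃ F : EC n → ℂ, ContDiffOn ℝ (⊤ : ℕ∞) F W ∧
      ∀ z, ∏ i ∈ S, (x i z + s z * b i z) = ∏ i ∈ S, x i z + s z * F z := by
  classical
  induction S using Finset.induction_on with
  | empty => exact ⟨fun _ => 0, contDiffOn_const, by simp⟩
  | insert i S hi ih =>
    obtain ⟨F, hF, h⟩ := ih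
    refine ⟨fun z => x i z * F z + b i z * (∏ i ∈ S, x i z) + s z * (b i z * F z), ?_, ?_⟩
    · exact (((hx i).mul hF).add ((hb i).mul (contDiffOn_prod fun i _ => hx i))).add
        (hs.mul ((hb i).mul hF))
    · intro z
      rw [Finset.prod_insert hi, Finset.prod_insert hi, h]
      ring

theorem aux_det_smooth {n : ℕ} {W : Set (EC n)} {ι : Type*} [Fintype ι] [DecidableEq ι]
    {X : EC n → Matrix ι ι ℂ}
    (hX : ∀ i j, ContDiffOn ℝ (⊤ : ℕ∞) (fun z => X z i j) W) :
    ContDiffOn ℝ (⊤ : ℕ∞) (fun z => (X z).det) W := by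
  simp only [Matrix.det_apply']
  exact ContDiffOn.sum fun σ _ => contDiffOn_const.mul (contDiffOn_prod fun i _ => hX _ _)

theorem aux_det_expand {n : ℕ} {W : Set (EC n)} {ι : Type*} [Fintype ι] [DecidableEq ι]
    {X B : EC n → Matrix ι ι ℂ} {s : EC n → ℂ}
    (hX : ∀ i j, ContDiffOn ℝ (⊤ : ℕ∞) (fun z => X z i j) W)
    (hB : ∀ i j, ContDiffOn ℝ (⊤ : ℕ∞) (fun z => B z i j) W)
    (hs : ContDiffOn ℝ (⊤ : ℕ∞) s W) :
    ∃ F : EC n → ℂ, ContDiffOn ℝ (⊤ : ℕ∞) F W ∧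
      ∀ z, (X z + s z • B z).det = (X z).det + s z * F z := by
  have h : ∀ σ : Equiv.Perm ι, _ := fun σ =>
    aux_prod_expand (W := W) (Finset.univ : Finset ι) (x := fun i z => X z (σ i) i)
      (b := fun i z => B z (σ i) i) (fun i => hX _ _) (fun i => hB _ _) hs
  choose F hF h using h
  refine ⟨fun z => ∑ σ : Equiv.Perm ι, ((Equiv.Perm.sign σ : ℤ) : ℂ) * F σ z,
    ContDiffOn.sum fun σ _ => contDiffOn_const.mul (hF σ), ?_⟩
  intro z
  simp only [Matrix.det_apply', Matrix.add_apply, Matrix.smul_apply, smul_eq_mul, h,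
    Finset.mul_sum, ← Finset.sum_add_distrib]
  exact Finset.sum_congr rfl fun σ _ => by ring

/-- Bordered determinant. -/
def bord {n : ℕ} (A : Matrix (Fin n) (Fin n) ℂ) (u v : Fin n → ℂ) : ℂ :=
  (Matrix.fromBlocks A (Matrix.replicateCol Unit u) (Matrix.replicateRow Unit (-v)) 0).det

theorem aux_det_rank_one {n : ℕ} (A : Matrix (Fin n) (Fin n) ℂ) (u v : Fin n → ℂ) (c : ℂ) :
    (A + c • Matrix.vecMulVec u v).det = A.det + c * bord A u v := by
  set M : Matrix (Fin n ⊕ Unit) (Fin n ⊕ Unit) ℂ :=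
    Matrix.fromBlocks A (Matrix.replicateCol Unit u) 0 0 with hM
  have h1 : (A + c • Matrix.vecMulVec u v) =
      A - Matrix.replicateCol Unit u * Matrix.replicateRow Unit (c • (-v)) := by
    ext i j
    simp [Matrix.vecMulVec_apply, Matrix.mul_apply]
    ring
  have h2 : Matrix.fromBlocks A (Matrix.replicateCol Unit u)
      (Matrix.replicateRow Unit (c • (-v))) 1 =
      M.updateRow (Sum.inr ()) (c • (Sum.elim (-v) (fun _ => (0 : ℂ)) : Fin n ⊕ Unit → ℂ) +
        (Sum.elim 0 (fun _ => 1) : Fin n ⊕ Unit → ℂ)) := by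
    ext i j
    rcases i with i | i <;> rcases j with j | j <;>
      simp [hM, Matrix.updateRow_apply]
  have h3 : bord A u v = (M.updateRow (Sum.inr ()) (Sum.elim (-v) (fun _ => 0))).det := by
    unfold bord
    congr 1
    ext i j
    rcases i with i | i <;> rcases j with j | j <;>
      simp [hM, Matrix.updateRow_apply]
  have h4 : A.det = (M.updateRow (Sum.inr ()) (Sum.elim 0 (fun _ => 1))).det := by
    have : M.updateRow (Sum.inr ()) (Sum.elim 0 (fun _ => 1)) =
        Matrix.fromBlocks A (Matrix.replicateCol Unit u) 0 1 := by
      ext i j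
      rcases i with i | i <;> rcases j with j | j <;>
        simp [hM, Matrix.updateRow_apply]
    rw [this, Matrix.det_fromBlocks_zero₂₁]
    simp
  rw [h1, ← Matrix.det_fromBlocks_one₂₂, h2, Matrix.det_updateRow_add, Matrix.det_updateRow_smul,
    ← h3, ← h4]
  ring

theorem aux_bord_ne {n : ℕ} (A : Matrix (Fin n) (Fin n) ℂ) (u v : Fin n → ℂ)
    (huv : ∀ i, v i = (starRingEnd ℂ) (u i)) (hu : u ≠ 0)
    (hpos : ∀ w : Fin n → ℂ, w ≠ 0 → ∑ j, u j * w j = 0 →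
      0 < (∑ i, ∑ j, A i j * w i * (starRingEnd ℂ) (w j)).re) : bord A u v ≠ 0 := by
  intro h
  obtain ⟨x, hx0, hx⟩ := Matrix.exists_mulVec_eq_zero_iff.mpr h
  have e1 : ∀ i, ∑ j, A i j * x (Sum.inl j) + u i * x (Sum.inr ()) = 0 := by
    intro i
    have := congrFun hx (Sum.inl i)
    simpa [Matrix.mulVec, dotProduct, Fintype.sum_sum_type] using this
  have e2 : ∑ j, v j * x (Sum.inl j) = 0 := by
    have := congrFun hx (Sum.inr ())
    simpa [Matrix.mulVec, dotProduct, Fintype.sum_sum_type] using this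
  set w : Fin n → ℂ := fun i => (starRingEnd ℂ) (x (Sum.inl i)) with hw
  have e3 : ∑ j, u j * w j = 0 := by
    have := congrArg (starRingEnd ℂ) e2
    simpa [huv, hw] using this
  have hw0 : w = 0 := by
    by_contra hne
    have hp := hpos w hne e3
    have : ∑ i, ∑ j, A i j * w i * (starRingEnd ℂ) (w j) = 0 := by
      have : ∀ i, ∑ j, A i j * w i * (starRingEnd ℂ) (w j) = - x (Sum.inr ()) * (u i * w i) := by
        intro i
        have h1 : ∑ j, A i j * w i * (starRingEnd ℂ) (w j)
            = w i * ∑ j, A i j * x (Sum.inl j) := by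
          rw [Finset.mul_sum]
          exact Finset.sum_congr rfl fun j _ => by simp [hw]; ring
        rw [h1]
        linear_combination w i * e1 i
      rw [Finset.sum_congr rfl fun i _ => this i, ← Finset.mul_sum, e3, mul_zero]
    rw [this] at hp
    simp at hp
  have hx1 : ∀ i, x (Sum.inl i) = 0 := by
    intro i
    have := congrFun hw0 i
    simpa [hw] using this
  apply hx0
  funext i
  rcases i with i | i
  · exact hx1 i
  · obtain ⟨k, hk⟩ := Function.ne_iff.mp hu
    have := e1 k
    simp [hx1] at this
    rcases this with h | h
    · exact absurd h hk
    · exact h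

theorem aux_bord_smooth {n : ℕ} {W : Set (EC n)} 
    {X : EC n → Matrix (Fin n) (Fin n) ℂ} {u v : EC n → Fin n → ℂ}
    (hX : ∀ i j, ContDiffOn ℝ (⊤ : ℕ∞) (fun z => X z i j) W)
    (hu : ∀ i, ContDiffOn ℝ (⊤ : ℕ∞) (fun z => u z i) W)
    (hv : ∀ i, ContDiffOn ℝ (⊤ : ℕ∞) (fun z => v z i) W) :
    ContDiffOn ℝ (⊤ : ℕ∞) (fun z => bord (X z) (u z) (v z)) W := by
  apply aux_det_smooth
  intro i j
  rcases i with i | i <;> rcases j with j | j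
  · simpa using hX i j
  · simpa using hu i
  · simpa using (hv j).neg
  · simpa using contDiffOn_const

theorem aux_herm_det_im {n : ℕ} {A : Matrix (Fin n) (Fin n) ℂ} (h : A.IsHermitian) :
    A.det = (A.det.re : ℂ) := by
  have : star A.det = A.det := by rw [← Matrix.det_conjTranspose, h.eq]
  exact (Complex.conj_eq_iff_re.mp this).symm

/-- Real second derivative. -/
def D2 {n : ℕ} (u : EC n → ℝ) (z : EC n) (v w : EC n) : ℝ := fderiv ℝ (fderiv ℝ u) z v w

def eR {n : ℕ} (i : Fin n) : EC n := EuclideanSpace.single i 1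
def eI {n : ℕ} (i : Fin n) : EC n := EuclideanSpace.single i Complex.I

theorem aux_fderiv_ofReal {n : ℕ} {u : EC n → ℝ} {z : EC n} (h : DifferentiableAt ℝ u z)
    (v : EC n) : fderiv ℝ (fun v => ((u v : ℝ) : ℂ)) z v = ((fderiv ℝ u z v : ℝ) : ℂ) := by
  have := (Complex.ofRealCLM.hasFDerivAt.comp z h.hasFDerivAt).fderiv
  have h2 : (⇑Complex.ofRealCLM ∘ u) = fun v => ((u v : ℝ) : ℂ) := rfl
  rw [h2] at this
  rw [this]; rfl

theorem aux_cz {n : ℕ} {u : EC n → ℝ} {z : EC n} (h : DifferentiableAt ℝ u z) (i : Fin n) :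
    cz n u z i = (fderiv ℝ u z (eR i) - Complex.I * fderiv ℝ u z (eI i)) / 2 := by
  simp only [cz, wDz, aux_fderiv_ofReal h, eR, eI]

theorem aux_czb {n : ℕ} {u : EC n → ℝ} {z : EC n} (h : DifferentiableAt ℝ u z) (i : Fin n) :
    czb n u z i = (fderiv ℝ u z (eR i) + Complex.I * fderiv ℝ u z (eI i)) / 2 := by
  simp only [czb, wDzBar, aux_fderiv_ofReal h, eR, eI]

theorem aux_czb_eq {n : ℕ} {u : EC n → ℝ} {z : EC n} (h : DifferentiableAt ℝ u z) (i : Fin n) :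
    czb n u z i = (starRingEnd ℂ) (cz n u z i) := by
  rw [aux_cz h, aux_czb h]
  simp [map_ofNat]

theorem aux_fderiv_D2 {n : ℕ} {W : Set (EC n)} (hW : IsOpen W) {u : EC n → ℝ}
    (hu : ContDiffOn ℝ (⊤ : ℕ∞) u W) {z : EC n} (hz : z ∈ W) (v e : EC n) :
    fderiv ℝ (fun y => fderiv ℝ u y e) z v = D2 u z v e := by
  have h : ContDiffOn ℝ (⊤ : ℕ∞) (fderiv ℝ u) W := hu.fderiv_of_isOpen hW (by simp)
  have hd := aux_diffAt hW h hz
  rw [fderiv_clm_apply hd (differentiableAt_const e)]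
  simp [D2]

theorem aux_cHess_eq {n : ℕ} {W : Set (EC n)} (hW : IsOpen W) {u : EC n → ℝ}
    (hu : ContDiffOn ℝ (⊤ : ℕ∞) u W) {z : EC n} (hz : z ∈ W) (i j : Fin n) :
    cHess n u z i j = (((D2 u z (eR i) (eR j) + D2 u z (eI i) (eI j) : ℝ) : ℂ) +
      Complex.I * ((D2 u z (eR i) (eI j) - D2 u z (eI i) (eR j) : ℝ) : ℂ)) / 4 := by
  have h : ContDiffOn ℝ (⊤ : ℕ∞) (fderiv ℝ u) W := hu.fderiv_of_isOpen hW (by simp)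
  have key : ∀ y ∈ W, wDzBar n j (fun v => ((u v : ℝ) : ℂ)) y =
      (1 / 2 : ℂ) * ((fderiv ℝ u y (eR j) : ℝ) : ℂ) +
        (Complex.I / 2) * ((fderiv ℝ u y (eI j) : ℝ) : ℂ) := by
    intro y hy
    have := aux_czb (aux_diffAt hW hu hy) j
    rw [czb] at this
    rw [this]; ring
  have s : ∀ e, ContDiffOn ℝ (⊤ : ℕ∞) (fun y => fderiv ℝ u y e) W :=
    fun e => h.clm_apply contDiffOn_const
  have sd : ∀ e, DifferentiableAt ℝ (fun y => fderiv ℝ u y e) z := fun e => aux_diffAt hW (s e) hz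
  have sc : ∀ e, DifferentiableAt ℝ (fun y => ((fderiv ℝ u y e : ℝ) : ℂ)) z :=
    fun e => aux_diffAt hW (aux_ofReal (s e)) hz
  have h1 : cHess n u z i j = _ := aux_wDz_congr hW key i hz
  rw [h1, aux_wDz_add i ((differentiableAt_const _).fun_mul (sc _))
    ((differentiableAt_const _).fun_mul (sc _)), aux_wDz_mul i (differentiableAt_const _) (sc _),
    aux_wDz_mul i (differentiableAt_const _) (sc _), aux_wDz_const, aux_wDz_const]
  simp only [wDz, aux_fderiv_ofReal (sd _), aux_fderiv_D2 hW hu hz]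
  change (1 / 2 : ℂ) * ((D2 u z (eR i) (eR j) - I * D2 u z (eI i) (eR j)) / 2) + 0 * _ + (I / 2 * ((D2 u z (eR i) (eI j) - I * D2 u z (eI i) (eI j)) / 2) + 0 * _) = _
  push_cast
  linear_combination (D2 u z (eI i) (eI j) : ℂ) * (-1/4) * Complex.I_sq

theorem aux_D2_symm {n : ℕ} {W : Set (EC n)} (hW : IsOpen W) {u : EC n → ℝ}
    (hu : ContDiffOn ℝ (⊤ : ℕ∞) u W) {z : EC n} (hz : z ∈ W) (v w : EC n) :
    D2 u z v w = D2 u z w v := by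
  have := (hu.contDiffAt (hW.mem_nhds hz)).isSymmSndFDerivAt
    (by rw [minSmoothness_of_isRCLikeNormedField]; exact WithTop.coe_le_coe.2 (le_top : (2 : ℕ∞) ≤ ⊤))
  exact this v w

theorem aux_cHess_herm {n : ℕ} {W : Set (EC n)} (hW : IsOpen W) {u : EC n → ℝ}
    (hu : ContDiffOn ℝ (⊤ : ℕ∞) u W) {z : EC n} (hz : z ∈ W) :
    (cHess n u z).IsHermitian := by
  ext i j
  simp only [Matrix.conjTranspose_apply, aux_cHess_eq hW hu hz]
  rw [aux_D2_symm hW hu hz (eR j) (eR i), aux_D2_symm hW hu hz (eI j) (eI i),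
    aux_D2_symm hW hu hz (eR j) (eI i), aux_D2_symm hW hu hz (eI j) (eR i)]
  simp
  ring

theorem aux_cHess_smooth {n : ℕ} {W : Set (EC n)} (hW : IsOpen W) {u : EC n → ℝ}
    (hu : ContDiffOn ℝ (⊤ : ℕ∞) u W) (i j : Fin n) :
    ContDiffOn ℝ (⊤ : ℕ∞) (fun z => cHess n u z i j) W :=
  aux_wDz_contDiffOn hW (aux_wDzBar_contDiffOn hW (aux_ofReal hu) j) i

def vec {n : ℕ} (w : Fin n → ℂ) : EC n := WithLp.toLp 2 w

theorem aux_vec {n : ℕ} (w : Fin n → ℂ) :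
    vec w = ∑ i, ((w i).re • eR i + (w i).im • eI i) := by
  ext k
  simp [vec, eR, eI, Finset.sum_apply, Finset.sum_add_distrib, Pi.single_apply]

theorem aux_Ivec {n : ℕ} (w : Fin n → ℂ) :
    vec (fun i => Complex.I * w i) = ∑ i, ((-(w i).im) • eR i + (w i).re • eI i) := by
  rw [aux_vec]
  simp

theorem aux_cGradPair {n : ℕ} {u : EC n → ℝ} {z : EC n} (h : DifferentiableAt ℝ u z)
    (w : Fin n → ℂ) :
    cGradPair n u z w = (fderiv ℝ u z (vec w) -
      Complex.I * fderiv ℝ u z (vec fun i => Complex.I * w i)) / 2 := by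
  rw [aux_vec, aux_Ivec]
  have h0 : cGradPair n u z w = ∑ j, cz n u z j * w j := rfl
  rw [h0]
  simp only [map_sum, map_add, map_smul, smul_eq_mul]
  push_cast
  rw [Finset.mul_sum, ← Finset.sum_sub_distrib, Finset.sum_div]
  refine Finset.sum_congr rfl fun j _ => ?_
  rw [aux_cz h]
  conv_lhs => rw [← Complex.re_add_im (w j)]
  linear_combination (-(fderiv ℝ u z (eI j) : ℂ) * (w j).im / 2) * Complex.I_sq

theorem aux_D2_sum {n : ℕ} (u : EC n → ℝ) (z : EC n) (x y : Fin n → ℝ) :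
    D2 u z (∑ i, (x i • eR i + y i • eI i)) (∑ i, (x i • eR i + y i • eI i)) =
    ∑ i, ∑ j, (x i * x j * D2 u z (eR i) (eR j) + x i * y j * D2 u z (eR i) (eI j) +
      y i * x j * D2 u z (eI i) (eR j) + y i * y j * D2 u z (eI i) (eI j)) := by
  unfold D2
  simp only [map_sum, map_add, map_smul, FunLike.coe_sum, Finset.sum_apply,
    add_apply, smul_apply, smul_eq_mul]
  rw [Finset.sum_comm (γ := Fin n) (s := Finset.univ) (t := Finset.univ)]
  refine Finset.sum_congr rfl fun i _ => ?_
  rw [Finset.mul_sum, Finset.mul_sum, ← Finset.sum_add_distrib]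
  refine Finset.sum_congr rfl fun j _ => ?_
  ring

theorem aux_form {n : ℕ} {W : Set (EC n)} (hW : IsOpen W) {u : EC n → ℝ}
    (hu : ContDiffOn ℝ (⊤ : ℕ∞) u W) {z : EC n} (hz : z ∈ W) (w : Fin n → ℂ) :
    (cHessForm n u z w).re = (D2 u z (vec w) (vec w) +
      D2 u z (vec fun i => Complex.I * w i) (vec fun i => Complex.I * w i)) / 4 := by
  rw [aux_vec, aux_Ivec, aux_D2_sum, aux_D2_sum]
  unfold cHessForm
  simp only [Complex.re_sum, ← Finset.sum_add_distrib, Finset.sum_div]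
  refine Finset.sum_congr rfl fun i _ => Finset.sum_congr rfl fun j _ => ?_
  rw [aux_cHess_eq hW hu hz]
  simp [Complex.mul_re, Complex.mul_im]
  ring

/-- Second-order Taylor estimate at a critical zero. -/
theorem aux_taylor {n : ℕ} {W : Set (EC n)} (hW : IsOpen W) {φ : EC n → ℝ}
    (hφ : ContDiffOn ℝ (⊤ : ℕ∞) φ W) {p : EC n} (hp : p ∈ W) (h0 : φ p = 0)
    (h1 : fderiv ℝ φ p = 0) (η : ℝ) (hη : 0 < η) :
    ∃ R > 0, ∀ h : EC n, ‖h‖ < R → |φ (p + h) - D2 φ p h h / 2| ≤ η * ‖h‖ ^ 2 := by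
  have hs : ContDiffOn ℝ (⊤ : ℕ∞) (fderiv ℝ φ) W := hφ.fderiv_of_isOpen hW (by simp)
  have hd := (aux_diffAt hW hs hp).hasFDerivAt
  set L := fderiv ℝ (fderiv ℝ φ) p with hL
  have ho := hasFDerivAt_iff_isLittleO_nhds_zero.mp hd
  have ho2 := ho.def hη
  obtain ⟨R1, hR1, hb⟩ := Metric.eventually_nhds_iff.mp ho2
  obtain ⟨R2, hR2, hW2⟩ := Metric.isOpen_iff.mp hW p hp
  refine ⟨min R1 R2, lt_min hR1 hR2, ?_⟩
  intro h hh
  set g : EC n → ℝ := fun y => φ (p + y) - L y y / 2 with hg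
  have hder : ∀ y : EC n, ‖y‖ < min R1 R2 →
      HasFDerivAt g (fderiv ℝ φ (p + y) - L y) y := by
    intro y hy
    have hyW : p + y ∈ W := hW2 (by
      rw [Metric.mem_ball, dist_eq_norm]; simpa using lt_of_lt_of_le hy (min_le_right _ _))
    have a1 : HasFDerivAt (fun y => φ (p + y)) (fderiv ℝ φ (p + y)) y := by
      have := (aux_diffAt hW hφ hyW).hasFDerivAt
      have h2 : HasFDerivAt (fun y => p + y) (ContinuousLinearMap.id ℝ (EC n)) y :=
        (hasFDerivAt_id y).const_add p
      have h3 := HasFDerivAt.comp (𝕜 := ℝ) y this h2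
      rw [ContinuousLinearMap.comp_id] at h3
      exact h3
    have a2 := (L.hasFDerivAt (x := y)).clm_apply (hasFDerivAt_id y)
    have a3 := a1.sub (a2.const_mul (1 / 2 : ℝ))
    refine (a3.congr_fderiv ?_).congr_of_eventuallyEq ?_
    · ext v
      have hsym : L v y = L y v := aux_D2_symm hW hφ hp v y
      simp [hsym]
      ring
    · filter_upwards with x
      simp [hg]
      ring
  have hbound : ∀ y ∈ Metric.closedBall (0 : EC n) ‖h‖, ‖fderiv ℝ φ (p + y) - L y‖ ≤ η * ‖h‖ := by
    intro y hy
    have hy' : ‖y‖ ≤ ‖h‖ := by simpa using hy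
    have := hb (y := y) (by simpa using lt_of_le_of_lt hy' (lt_of_lt_of_le hh (min_le_left _ _)))
    rw [h1, sub_zero] at this
    exact this.trans (by gcongr)
  have := (convex_closedBall (0 : EC n) ‖h‖).norm_image_sub_le_of_norm_hasFDerivWithin_le
    (f := g) (f' := fun y => fderiv ℝ φ (p + y) - L y) (C := η * ‖h‖)
    (fun y hy => (hder y (lt_of_le_of_lt (by simpa using hy) hh)).hasFDerivWithinAt)
    hbound (x := 0) (y := h) (by simp) (by simp)
  have g0 : g 0 = 0 := by simp [hg, h0]
  rw [g0, sub_zero, sub_zero, Real.norm_eq_abs] at this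
  calc _ = |g h| := rfl
    _ ≤ _ := this
    _ = _ := by ring

theorem aux_seg {X : Type*} [TopologicalSpace X] {Ω : Set X} {f : ℝ → X}
    (hf : Continuous f) {a b : ℝ} (hab : a ≤ b) (hb : f b ∈ Ω) (ha : f a ∉ Ω) :
    ∃ s ∈ Set.Icc a b, f s ∈ frontier Ω := by
  by_contra hcon
  push Not at hcon
  have hpre : IsPreconnected (f '' Set.Icc a b) := isPreconnected_Icc.image f hf.continuousOn
  have hsub : f '' Set.Icc a b ⊆ interior Ω ∪ (closure Ω)ᶜ := by
    rintro _ ⟨s, hs, rfl⟩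
    have := hcon s hs
    by_cases h : f s ∈ closure Ω
    · left
      by_contra h2
      exact this ⟨h, h2⟩
    · right; exact h
  have hbm : f b ∈ f '' Set.Icc a b := ⟨b, ⟨hab, le_refl _⟩, rfl⟩
  have ham : f a ∈ f '' Set.Icc a b := ⟨a, ⟨le_refl _, hab⟩, rfl⟩
  have hbi : f b ∈ interior Ω := by
    rcases hsub hbm with h | h
    · exact h
    · exact absurd (subset_closure hb) h
  have hai : f a ∈ (closure Ω)ᶜ := by
    rcases hsub ham with h | h
    · exact absurd (interior_subset h) ha
    · exact h
  obtain ⟨x, _, hx1, hx2⟩ := hpre _ _ isOpen_interior isClosed_closure.isOpen_compl hsub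
    ⟨_, hbm, hbi⟩ ⟨_, ham, hai⟩
  exact hx2 (subset_closure (interior_subset hx1))

theorem aux_line_deriv {n : ℕ} {f : EC n → ℝ} {p v : EC n} (hf : DifferentiableAt ℝ f p) :
    HasDerivAt (fun t : ℝ => f (p + t • v)) (fderiv ℝ f p v) 0 := by
  have h := hf.hasFDerivAt
  have h2 : HasDerivAt (fun t : ℝ => p + t • v) v 0 := by
    simpa using ((hasDerivAt_id (0 : ℝ)).smul_const v).const_add p
  have h3 : HasFDerivAt f (fderiv ℝ f p) (p + (0 : ℝ) • v) := by simpa using h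
  exact h3.comp_hasDerivAt 0 h2

theorem aux_line_neg {n : ℕ} {f : EC n → ℝ} {p v : EC n} (hf : DifferentiableAt ℝ f p)
    (h0 : f p = 0) (hv : fderiv ℝ f p v < 0) :
    ∀ᶠ t : ℝ in nhdsWithin 0 (Set.Ioi 0), f (p + t • v) < 0 := by
  have h := (aux_line_deriv (v := v) hf).hasDerivWithinAt (s := Set.Ioi 0)
  have h2 := hasDerivWithinAt_iff_tendsto_slope.mp h
  have h3 : Set.Ioi (0 : ℝ) \ {0} = Set.Ioi 0 := by
    ext x; simp only [Set.mem_sdiff, Set.mem_Ioi, Set.mem_singleton_iff]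
    constructor
    · exact fun h => h.1
    · exact fun h => ⟨h, h.ne'⟩
  rw [h3] at h2
  filter_upwards [h2.eventually_lt_const hv, self_mem_nhdsWithin] with t ht htp
  have htp : 0 < t := htp
  simp only [slope_def_field, zero_smul, add_zero, h0, sub_zero] at ht
  by_contra hcon
  push Not at hcon
  exact absurd ht (not_lt.mpr (div_nonneg hcon htp.le))

section geo

variable {n : ℕ} {Ω U V : Set (EC n)} {ρ d : EC n → ℝ}

theorem aux_rho_zero (hΩ : IsOpen Ω) (hdef : IsDefiningFn n ⊤ Ω U ρ) {q : EC n}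
    (hq : q ∈ frontier Ω) : ρ q = 0 := by
  obtain ⟨hU, hcl, hs, hΩe, _⟩ := hdef
  have hqU : q ∈ U := hcl hq.1
  have hqn : q ∉ Ω := by
    have := hq.2; rwa [hΩ.interior_eq] at this
  apply le_antisymm
  · have hc : ContinuousAt ρ q := (hs.continuousOn).continuousAt (hU.mem_nhds hqU)
    have := mem_closure_iff_nhdsWithin_neBot.mp hq.1
    refine le_of_tendsto (hc.tendsto.mono_left (nhdsWithin_le_nhds (s := Ω))) ?_
    filter_upwards [self_mem_nhdsWithin] with x hx
    rw [hΩe] at hx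
    exact hx.2.le
  · by_contra h
    push Not at h
    apply hqn
    rw [hΩe]
    exact ⟨hqU, h⟩

theorem aux_d_zero (hVb : frontier Ω ⊆ V)
    (hdδ : ∀ z ∈ V ∩ closure Ω, d z = Metric.infDist z (frontier Ω)) {q : EC n}
    (hq : q ∈ frontier Ω) : d q = 0 := by
  rw [hdδ q ⟨hVb hq, hq.1⟩]
  exact Metric.infDist_zero_of_mem hq

theorem aux_lower (hΩ : IsOpen Ω) (hdef : IsDefiningFn n ⊤ Ω U ρ)
    (hV : IsOpen V) (hVb : frontier Ω ⊆ V)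
    (hdδ : ∀ z ∈ V ∩ closure Ω, d z = Metric.infDist z (frontier Ω)) {p : EC n}
    (hp : p ∈ frontier Ω) :
    ∃ c > 0, ∀ᶠ z in nhds p, z ∈ Ω → -(c * ρ z) ≤ d z := by
  have hdef' := hdef
  obtain ⟨hU, hcl, hs, hΩe, _⟩ := hdef
  have hpU : p ∈ U := hcl hp.1
  have hC : ContDiffAt ℝ 1 ρ p :=
    (hs.contDiffAt (hU.mem_nhds hpU)).of_le (WithTop.coe_le_coe.2 (le_top : (1 : ℕ∞) ≤ ⊤))
  obtain ⟨K, T, hT, hK⟩ := hC.exists_lipschitzOnWith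
  obtain ⟨R, hR, hRT⟩ := Metric.mem_nhds_iff.mp hT
  refine ⟨1 / (K + 1), by positivity, ?_⟩
  filter_upwards [Metric.ball_mem_nhds p (half_pos hR), hV.mem_nhds (hVb hp)] with z hz hzV hzΩ
  obtain ⟨q, hq, hqe⟩ := isClosed_frontier.exists_infDist_eq_dist ⟨p, hp⟩ z
  have hzq : dist z q ≤ dist z p := hqe ▸ Metric.infDist_le_dist_of_mem hp
  have hzp : dist z p < R / 2 := hz
  have hqp : dist q p < R := by
    calc dist q p ≤ dist q z + dist z p := dist_triangle _ _ _
      _ < R := by rw [dist_comm q z]; linarith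
  have := hK.dist_le_mul z (hRT (by rw [Metric.mem_ball]; linarith)) q (hRT hqp)
  rw [Real.dist_eq, aux_rho_zero hΩ hdef' hq, sub_zero] at this
  rw [hdδ z ⟨hzV, subset_closure hzΩ⟩, hqe]
  have h1 : -ρ z ≤ (K + 1) * dist z q := by
    have := neg_abs_le (ρ z)
    have h2 := dist_nonneg (x := z) (y := q)
    linarith
  have : (0 : ℝ) < K + 1 := by positivity
  rw [← mul_neg, div_mul_eq_mul_div, one_mul, div_le_iff₀ this]
  linarith

theorem aux_first (hΩ : IsOpen Ω) (hdef : IsDefiningFn n ⊤ Ω U ρ)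
    (hV : IsOpen V) (hVb : frontier Ω ⊆ V) (hd : ContDiffOn ℝ (⊤ : ℕ∞) d V)
    (hdδ : ∀ z ∈ V ∩ closure Ω, d z = Metric.infDist z (frontier Ω)) {p : EC n}
    (hp : p ∈ frontier Ω) :
    ∃ l > 0, ∀ v, fderiv ℝ d p v = -l * fderiv ℝ ρ p v := by
  obtain ⟨c, hc, hlow⟩ := aux_lower hΩ hdef hV hVb hdδ hp
  have hp0 := aux_rho_zero hΩ hdef hp
  have hd0 := aux_d_zero hVb hdδ hp
  obtain ⟨hU, hcl, hs, hΩe, hne⟩ := hdef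
  have hpU : p ∈ U := hcl hp.1
  have hρd : DifferentiableAt ℝ ρ p := aux_diffAt hU hs hpU
  have hdd : DifferentiableAt ℝ d p := aux_diffAt hV hd (hVb hp)
  have key : ∀ v, fderiv ℝ ρ p v < 0 → -(c * fderiv ℝ ρ p v) ≤ fderiv ℝ d p v := by
    intro v hv
    by_contra hcon
    push Not at hcon
    have hψ : DifferentiableAt ℝ (fun z => d z + c * ρ z) p := hdd.fun_add (hρd.const_mul c)
    have hψv : fderiv ℝ (fun z => d z + c * ρ z) p v < 0 := by
      rw [fderiv_fun_add hdd (hρd.const_mul c), fderiv_const_mul hρd]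
      simp
      linarith
    have h1 := aux_line_neg hψ (by simp [hp0, hd0]) hψv
    have h2 := aux_line_neg hρd hp0 hv
    have hcont : Filter.Tendsto (fun t : ℝ => p + t • v) (nhdsWithin 0 (Set.Ioi 0)) (nhds p) := by
      have : Continuous fun t : ℝ => p + t • v := by fun_prop
      have := (this.tendsto 0).mono_left (nhdsWithin_le_nhds (s := Set.Ioi 0))
      simpa using this
    have h3 := hcont.eventually hlow
    have h4 := hcont.eventually (hU.mem_nhds hpU)
    obtain ⟨t, h1, h2, h3, h4⟩ := (h1.and (h2.and (h3.and h4))).exists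
    have := h3 (by rw [hΩe]; exact ⟨h4, h2⟩)
    linarith
  obtain ⟨ν0, hν0⟩ : ∃ v, fderiv ℝ ρ p v ≠ 0 := by
    by_contra hcon
    push Not at hcon
    exact hne p hp (by ext v; simp [hcon v])
  set ν : EC n := (-(fderiv ℝ ρ p ν0)⁻¹) • ν0 with hν
  have hν1 : fderiv ℝ ρ p ν = -1 := by
    rw [hν, map_smul, smul_eq_mul]; field_simp
  have hker : ∀ w, fderiv ℝ ρ p w = 0 → fderiv ℝ d p w = 0 := by
    intro w hw
    by_contra hne
    have := key (ν + (-(fderiv ℝ d p ν) / fderiv ℝ d p w) • w) (by simp [hw, hν1])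
    simp only [map_add, map_smul, hw, hν1, smul_eq_mul] at this
    rw [div_mul_cancel₀ _ hne] at this
    linarith
  have hl : 0 < fderiv ℝ d p ν := by
    have := key ν (by simp [hν1])
    rw [hν1] at this
    linarith
  refine ⟨_, hl, fun v => ?_⟩
  have := hker (v + fderiv ℝ ρ p v • ν) (by simp [hν1])
  simp only [map_add, map_smul, smul_eq_mul] at this
  linarith

theorem aux_second (hΩ : IsOpen Ω) (hdef : IsDefiningFn n ⊤ Ω U ρ)
    (hV : IsOpen V) (hVb : frontier Ω ⊆ V) (hd : ContDiffOn ℝ (⊤ : ℕ∞) d V)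
    (hdδ : ∀ z ∈ V ∩ closure Ω, d z = Metric.infDist z (frontier Ω)) {p : EC n}
    (hp : p ∈ frontier Ω) {l : ℝ} (hl : ∀ v, fderiv ℝ d p v = -l * fderiv ℝ ρ p v)
    {w : EC n} (hw : fderiv ℝ ρ p w = 0) :
    D2 d p w w = -l * D2 ρ p w w := by
  have hz0 : ∀ q ∈ frontier Ω, ρ q = 0 := fun q hq => aux_rho_zero hΩ hdef hq
  have hd0 : ∀ q ∈ frontier Ω, d q = 0 := fun q hq => aux_d_zero hVb hdδ hq
  obtain ⟨hU, hcl, hs, hΩe, hne⟩ := hdef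
  have hpU : p ∈ U := hcl hp.1
  have hpV := hVb hp
  have hρd : DifferentiableAt ℝ ρ p := aux_diffAt hU hs hpU
  have hdd : DifferentiableAt ℝ d p := aux_diffAt hV hd hpV
  obtain ⟨ν, hν⟩ : ∃ v, fderiv ℝ ρ p v < 0 := by
    by_contra hcon
    push Not at hcon
    apply hne p hp
    ext v
    have h1 := hcon v
    have h2 := hcon (-v)
    simp only [map_neg] at h2
    simp
    linarith
  have hW : IsOpen (U ∩ V) := hU.inter hV
  have hpW : p ∈ U ∩ V := ⟨hpU, hpV⟩
  have hsW := hs.mono (Set.inter_subset_left (t := V))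
  have hdW := hd.mono (Set.inter_subset_right (s := U))
  have hφ : ContDiffOn ℝ (⊤ : ℕ∞) (fun z => d z + l * ρ z) (U ∩ V) :=
    hdW.add (contDiffOn_const.mul hsW)
  set φ : EC n → ℝ := fun z => d z + l * ρ z with hφdef
  have hφ1 : fderiv ℝ φ p = 0 := by
    ext v
    rw [hφdef, fderiv_fun_add hdd (hρd.const_mul l), fderiv_const_mul hρd]
    simp [hl]
  have hφf : ∀ q ∈ frontier Ω, φ q = 0 := fun q hq => by simp [hφdef, hz0 q hq, hd0 q hq]
  have hD2 : D2 φ p w w = D2 d p w w + l * D2 ρ p w w := by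
    rw [← aux_fderiv_D2 hW hφ hpW, ← aux_fderiv_D2 hW hdW hpW, ← aux_fderiv_D2 hW hsW hpW]
    have e : (fun y => fderiv ℝ φ y w) =ᶠ[nhds p]
        fun y => fderiv ℝ d y w + l * fderiv ℝ ρ y w := by
      filter_upwards [hW.mem_nhds hpW] with y hy
      have a1 := aux_diffAt hW hdW hy
      have a2 := aux_diffAt hW hsW hy
      rw [hφdef, fderiv_fun_add a1 (a2.const_mul l), fderiv_const_mul a2]
      simp
    have b1 : DifferentiableAt ℝ (fun y => fderiv ℝ d y w) p :=
      aux_diffAt hW ((hdW.fderiv_of_isOpen hW (by simp)).clm_apply contDiffOn_const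
        : ContDiffOn ℝ (⊤ : ℕ∞) _ _) hpW
    have b2 : DifferentiableAt ℝ (fun y => fderiv ℝ ρ y w) p :=
      aux_diffAt hW ((hsW.fderiv_of_isOpen hW (by simp)).clm_apply contDiffOn_const
        : ContDiffOn ℝ (⊤ : ℕ∞) _ _) hpW
    rw [e.fderiv_eq, fderiv_fun_add b1 (b2.const_mul l), fderiv_const_mul b2]
    simp
  have main : ∀ ε > 0, ∃ s : ℝ, |s| ≤ ε ∧
      |D2 φ p (w + s • ν) (w + s • ν)| ≤ 2 * ε * ‖w + s • ν‖ ^ 2 := by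
    intro ε hε
    obtain ⟨R, hR, hT⟩ := aux_taylor hW hφ hpW (hφf p hp) hφ1 ε hε
    have t1 := aux_line_neg (v := w + ε • ν) hρd (hz0 p hp) (by simp [hw]; nlinarith)
    have t2 := aux_line_neg (f := fun z => -ρ z) (v := w + (-ε) • ν) hρd.fun_neg
      (by simp [hz0 p hp]) (by simp [hw]; nlinarith)
    have hcont : ∀ v : EC n,
        Filter.Tendsto (fun t : ℝ => p + t • v) (nhdsWithin 0 (Set.Ioi 0)) (nhds p) := by
      intro v
      have : Continuous fun t : ℝ => p + t • v := by fun_prop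
      have := (this.tendsto 0).mono_left (nhdsWithin_le_nhds (s := Set.Ioi 0))
      simpa using this
    have t3 := (hcont (w + ε • ν)).eventually (hU.mem_nhds hpU)
    have t4 : ∀ᶠ t : ℝ in nhdsWithin 0 (Set.Ioi 0), t * (‖w‖ + ε * ‖ν‖) < R := by
      have : Continuous fun t : ℝ => t * (‖w‖ + ε * ‖ν‖) := by fun_prop
      have := (this.tendsto 0).mono_left (nhdsWithin_le_nhds (s := Set.Ioi 0))
      exact this.eventually_lt_const (by simpa using hR)
    have t5 : ∀ᶠ t : ℝ in nhdsWithin 0 (Set.Ioi 0), 0 < t := self_mem_nhdsWithin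
    obtain ⟨t, t1, t2, t3, t4, t5⟩ := (t1.and (t2.and (t3.and (t4.and t5)))).exists
    obtain ⟨s, hs, hsf⟩ := aux_seg (Ω := Ω) (f := fun s : ℝ => p + t • (w + s • ν))
      (by fun_prop) (a := -ε) (b := ε) (by linarith) (by rw [hΩe]; exact ⟨t3, t1⟩)
      (by
        intro hmem
        rw [hΩe] at hmem
        have := hmem.2
        linarith)
    have hsε : |s| ≤ ε := abs_le.mpr hs
    refine ⟨s, hsε, ?_⟩
    have hn : ‖w + s • ν‖ ≤ ‖w‖ + ε * ‖ν‖ := by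
      refine (norm_add_le _ _).trans ?_
      rw [norm_smul, Real.norm_eq_abs]
      gcongr
    have := hT (t • (w + s • ν)) (by
      rw [norm_smul, Real.norm_eq_abs, abs_of_pos t5]
      exact lt_of_le_of_lt (by gcongr) t4)
    rw [hφf _ hsf] at this
    have e : D2 φ p (t • (w + s • ν)) (t • (w + s • ν)) =
        t ^ 2 * D2 φ p (w + s • ν) (w + s • ν) := by
      simp only [D2, map_smul, smul_apply, smul_eq_mul]; ring
    rw [e, norm_smul, Real.norm_eq_abs, abs_of_pos t5, zero_sub, abs_neg, abs_div, abs_mul,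
      abs_of_pos (by positivity : (0 : ℝ) < t ^ 2), abs_of_pos (by norm_num : (0 : ℝ) < 2)] at this
    have t6 : 0 < t ^ 2 := by positivity
    refine le_of_mul_le_mul_left (a := t ^ 2) ?_ t6
    nlinarith
  have hfin : D2 φ p w w = 0 := by
    have : ∀ k : ℕ, ∃ s : ℝ, |s| ≤ 1 / ((k : ℝ) + 1) ∧
      |D2 φ p (w + s • ν) (w + s • ν)| ≤ 2 * (1 / ((k : ℝ) + 1)) * ‖w + s • ν‖ ^ 2 :=
      fun k => main _ (by positivity)
    choose s hs1 hs2 using this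
    have hs0 : Filter.Tendsto s Filter.atTop (nhds 0) :=
      squeeze_zero_norm hs1 tendsto_one_div_add_atTop_nhds_zero_nat
    have c1 : Continuous fun s : ℝ => |D2 φ p (w + s • ν) (w + s • ν)| := by
      unfold D2; fun_prop
    have c2 : Continuous fun s : ℝ => ‖w + s • ν‖ ^ 2 := by fun_prop
    have l1 := (c1.tendsto 0).comp hs0
    have l2 := ((tendsto_one_div_add_atTop_nhds_zero_nat (𝕜 := ℝ)).const_mul 2).mul
      ((c2.tendsto 0).comp hs0)
    have := le_of_tendsto_of_tendsto' l1 l2 hs2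
    simp at this
    exact this
  linarith

end geo

theorem aux_ind {n : ℕ} {Γ V : Set (EC n)} {d : EC n → ℝ} (hV : IsOpen V) (hVb : Γ ⊆ V)
    (hd : ContDiffOn ℝ (⊤ : ℕ∞) d V) (hd0 : ∀ p ∈ Γ, d p = 0) (hcz : ∀ p ∈ Γ, cz n d p ≠ 0)
    (hbase : ∀ p ∈ Γ, ∀ w : Fin n → ℂ, w ≠ 0 → ∑ j, cz n d p j * w j = 0 →
      0 < (cHessForm n (fun z => -d z) p w).re) (k : ℕ) :
    ∃ (W : Set (EC n)) (a : ℕ → EC n → ℝ) (E : EC n → ℝ), IsOpen W ∧ W ⊆ V ∧ Γ ⊆ W ∧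
      (∀ j, ContDiffOn ℝ (⊤ : ℕ∞) (a j) W) ∧ ContDiffOn ℝ (⊤ : ℕ∞) E W ∧
      (∀ z ∈ W, (cHess n (fun z => -d z + ∑ j ∈ Finset.Icc 2 (k + 1), a j z * d z ^ j) z).det =
        ((d z ^ k * E z : ℝ) : ℂ)) ∧
      ∀ p ∈ Γ, ∀ w : Fin n → ℂ, w ≠ 0 → ∑ j, cz n d p j * w j = 0 →
        0 < (cHessForm n (fun z => -d z + ∑ j ∈ Finset.Icc 2 (k + 1), a j z * d z ^ j) p w).re := by
  induction k with
  | zero =>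
    have hnd : ContDiffOn ℝ (⊤ : ℕ∞) (fun z => -d z) V := hd.neg
    refine ⟨V, fun _ _ => 0, fun z => (cHess n (fun z => -d z) z).det.re, hV, le_refl _, hVb,
      fun _ => contDiffOn_const, aux_re (aux_det_smooth (aux_cHess_smooth hV hnd)), ?_, ?_⟩
    · intro z hz
      simp only [zero_mul, Finset.sum_const_zero, add_zero, pow_zero, one_mul]
      exact aux_herm_det_im (aux_cHess_herm hV hnd hz)
    · simpa using hbase
  | succ k ih =>
    obtain ⟨W, a, E, hW, hWV, hΓW, ha, hE, hdet, hpos⟩ := ih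
    set r : EC n → ℝ := fun z => -d z + ∑ j ∈ Finset.Icc 2 (k + 1), a j z * d z ^ j with hr
    have hdW := hd.mono hWV
    have hrs : ContDiffOn ℝ (⊤ : ℕ∞) r W :=
      hdW.neg.add (ContDiffOn.sum fun j _ => (ha j).mul (hdW.pow j))
    have hczs : ∀ i, ContDiffOn ℝ (⊤ : ℕ∞) (fun z => cz n d z i) W :=
      fun i => aux_wDz_contDiffOn hW (aux_ofReal hdW) i
    have hczbs : ∀ i, ContDiffOn ℝ (⊤ : ℕ∞) (fun z => czb n d z i) W :=
      fun i => aux_wDzBar_contDiffOn hW (aux_ofReal hdW) i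
    have hHs := aux_cHess_smooth hW hrs
    set Q : EC n → ℝ := fun z => (bord (cHess n r z) (cz n d z) (czb n d z)).re with hQ
    have hQs : ContDiffOn ℝ (⊤ : ℕ∞) Q W := aux_re (aux_bord_smooth hHs hczs hczbs)
    have hczb : ∀ z ∈ W, ∀ i, czb n d z i = (starRingEnd ℂ) (cz n d z i) :=
      fun z hz i => aux_czb_eq (aux_diffAt hW hdW hz) i
    have hQr : ∀ z ∈ W, bord (cHess n r z) (cz n d z) (czb n d z) = (Q z : ℂ) := by
      intro z hz
      have h1 := aux_cHess_herm hW hrs hz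
      have h2 : (Matrix.vecMulVec (cz n d z) (czb n d z)).IsHermitian := by
        ext i j
        simp only [Matrix.conjTranspose_apply, Matrix.vecMulVec_apply, hczb z hz]
        simp
        ring
      have h3 := aux_det_rank_one (cHess n r z) (cz n d z) (czb n d z) 1
      rw [one_smul, one_mul] at h3
      have h4 := aux_herm_det_im (h1.add h2)
      have h5 := aux_herm_det_im h1
      have h6 : bord (cHess n r z) (cz n d z) (czb n d z) =
        (((cHess n r z + Matrix.vecMulVec (cz n d z) (czb n d z)).det.re
          - (cHess n r z).det.re : ℝ) : ℂ) := by
        push_cast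
        rw [← h4, ← h5, h3]; ring
      rw [hQ]
      simp only
      rw [h6, Complex.ofReal_re]
    have hQne : ∀ p ∈ Γ, Q p ≠ 0 := by
      intro p hp h0
      apply aux_bord_ne (cHess n r p) (cz n d p) (czb n d p) (hczb p (hΓW hp)) (hcz p hp)
        (hpos p hp)
      rw [hQr p (hΓW hp), h0]; simp
    set W' := W ∩ Q ⁻¹' {0}ᶜ with hW'
    have hWo1 : IsOpen W' := hQs.continuousOn.isOpen_inter_preimage hW isOpen_compl_singleton
    have hsub : W' ⊆ W := Set.inter_subset_left
    have hQ' : ∀ z ∈ W', Q z ≠ 0 := fun z hz => hz.2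
    set b : EC n → ℝ := fun z => -E z / (((k : ℝ) + 1) * (k + 2) * Q z) with hb
    have hbs : ContDiffOn ℝ (⊤ : ℕ∞) b W' :=
      ((hE.mono hsub).neg).div (contDiffOn_const.mul (hQs.mono hsub))
        (fun z hz => mul_ne_zero (by positivity) (hQ' z hz))
    have hr' : (fun z => -d z + ∑ j ∈ Finset.Icc 2 (k + 1 + 1),
        Function.update a (k + 2) b j z * d z ^ j) = fun z => r z + b z * d z ^ (k + 2) := by
      funext z
      rw [Finset.sum_Icc_succ_top (by omega), hr]
      have : ∑ j ∈ Finset.Icc 2 (k + 1), Function.update a (k + 2) b j z * d z ^ j =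
          ∑ j ∈ Finset.Icc 2 (k + 1), a j z * d z ^ j := by
        refine Finset.sum_congr rfl fun j hj => ?_
        rw [Function.update_of_ne]
        have := (Finset.mem_Icc.mp hj).2
        omega
      rw [this]
      simp [add_assoc]
    obtain ⟨B, hB, hHess⟩ := aux_cHess_step hWo1 (hdW.mono hsub) hbs (hrs.mono hsub) k
    set c : EC n → ℝ := fun z => ((k + 1 : ℝ) * (k + 2) * b z * d z ^ k : ℝ) with hc
    have hcs : ContDiffOn ℝ (⊤ : ℕ∞) c W' :=
      (contDiffOn_const.mul hbs).mul ((hdW.mono hsub).pow k)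
    obtain ⟨F, hF, hexp⟩ := aux_det_expand (W := W')
      (X := fun z => cHess n r z + ((c z : ℝ) : ℂ) • Matrix.vecMulVec (cz n d z) (czb n d z))
      (B := B) (s := fun z => (d z : ℂ) ^ (k + 1))
      (by
        intro i j
        exact ((hHs i j).mono hsub).add ((aux_ofReal hcs).mul
          (((hczs i).mono hsub).mul ((hczbs j).mono hsub)))) hB
      ((aux_ofReal (hdW.mono hsub)).pow _)
    have hΓ' : Γ ⊆ W' := fun p hp => ⟨hΓW hp, hQne p hp⟩
    have hrs1 : ContDiffOn ℝ (⊤ : ℕ∞) (fun z => r z + b z * d z ^ (k + 2)) W' :=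
      (hrs.mono hsub).add (hbs.mul ((hdW.mono hsub).pow _))
    refine ⟨W', Function.update a (k + 2) b, fun z => (F z).re, hWo1, hsub.trans hWV, hΓ', ?_,
      aux_re hF, ?_, ?_⟩
    · intro j
      by_cases hj : j = k + 2
      · subst hj; simpa using hbs
      · rw [Function.update_of_ne hj]; exact (ha j).mono hsub
    · rw [hr']
      intro z hz
      have h1 : (cHess n (fun v => r v + b v * d v ^ (k + 2)) z).det =
          ((d z ^ (k + 1) : ℝ) : ℂ) * F z := by
        rw [hHess z hz]
        refine (hexp z).trans ?_
        rw [aux_det_rank_one, hdet z (hsub hz), hQr z (hsub hz)]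
        have : d z ^ k * E z + c z * Q z = 0 := by
          have := hQ' z hz
          simp only [hc, hb]
          field_simp
          ring
        have h2 : ((d z ^ k * E z : ℝ) : ℂ) + (c z : ℂ) * (Q z : ℂ) = 0 := by
          exact_mod_cast this
        rw [h2, zero_add]
        push_cast
        rfl
      rw [aux_herm_det_im (aux_cHess_herm hWo1 hrs1 hz), h1, Complex.re_ofReal_mul]
    · rw [hr']
      intro p hp w hw hw0
      have : cHessForm n (fun v => r v + b v * d v ^ (k + 2)) p w = cHessForm n r p w := by
        unfold cHessForm
        rw [hHess p (hΓ' hp), hd0 p hp]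
        simp only [Complex.ofReal_zero, ne_eq, Nat.add_eq_zero_iff, one_ne_zero, and_false,
          not_false_eq_true, zero_pow, zero_smul, Matrix.add_apply, Matrix.smul_apply,
          Matrix.vecMulVec_apply, smul_eq_mul]
        set q : ℂ := (((k + 1 : ℝ) * (k + 2) * b p * 0 ^ k : ℝ) : ℂ)
        have e : ∑ i, ∑ j, q * (cz n d p i * czb n d p j) * w i * (starRingEnd ℂ) (w j) =
            (∑ i, cz n d p i * w i) * (q * ∑ j, czb n d p j * (starRingEnd ℂ) (w j)) := by
          rw [Finset.sum_mul]
          refine Finset.sum_congr rfl fun i _ => ?_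
          rw [Finset.mul_sum, Finset.mul_sum]
          exact Finset.sum_congr rfl fun j _ => by ring
        simp only [add_mul, Finset.sum_add_distrib]
        rw [e, hw0, zero_mul, add_zero]
        simp only [Matrix.zero_apply, zero_mul, Finset.sum_const_zero, add_zero]
      rw [this]
      exact hpos p hp w hw hw0

/-- Near the boundary of a bounded strictly pseudoconvex domain with
`C^∞` boundary one can correct the (smooth extension `d` of the) boundary-distance
function `δ` by terms `a_k δ^k`, `2 ≤ k ≤ m`, so that `r = -δ + Σ a_k δ^k` is a local
defining function with `|det H(r)| ≤ C δ^{m-1}` near `∂Ω`. -/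
theorem distance_correction (n : ℕ)
    (Ω : Set (EuclideanSpace ℂ (Fin n)))
    (hΩ : IsStrictlyPseudoconvexDomain n ⊤ Ω)
    (V : Set (EuclideanSpace ℂ (Fin n))) (hV : IsOpen V) (hVb : frontier Ω ⊆ V)
    (d : EuclideanSpace ℂ (Fin n) → ℝ)
    (hd : ContDiffOn ℝ (⊤ : ℕ∞) d V)
    (hdδ : ∀ z ∈ V ∩ closure Ω, d z = Metric.infDist z (frontier Ω)) :
    ∀ m : ℕ, 2 ≤ m →
      ∃ (Vm : Set (EuclideanSpace ℂ (Fin n))) (a : ℕ → EuclideanSpace ℂ (Fin n) → ℝ)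
        (r : EuclideanSpace ℂ (Fin n) → ℝ) (C : ℝ),
        IsOpen Vm ∧ Vm ⊆ V ∧ frontier Ω ⊆ Vm ∧
        (∀ k ∈ Finset.Icc 2 m, ContDiffOn ℝ (⊤ : ℕ∞) (a k) Vm) ∧
        (∀ z, r z = -d z + ∑ k ∈ Finset.Icc 2 m, a k z * d z ^ k) ∧
        (∀ z ∈ Vm ∩ Ω, r z < 0) ∧
        (∀ z ∈ frontier Ω, r z = 0) ∧
        (∀ z ∈ frontier Ω, fderiv ℝ r z ≠ 0) ∧
        0 < C ∧
        (∀ z ∈ Vm ∩ Ω,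
          ‖(cHess n r z).det‖ ≤ C * Metric.infDist z (frontier Ω) ^ (m - 1)) := by
  intro m hm
  obtain ⟨hΩo, hΩb, U, ρ, hdef, hpc⟩ := hΩ
  by_cases hne : (frontier Ω).Nonempty
  swap
  · rw [Set.not_nonempty_iff_eq_empty] at hne
    refine ⟨∅, fun _ _ => 0, _, 1, isOpen_empty, Set.empty_subset _, by rw [hne],
      fun _ _ => contDiffOn_const, fun z => rfl, ?_, ?_, ?_, one_pos, ?_⟩ <;> simp [hne]
  have hd0 : ∀ p ∈ frontier Ω, d p = 0 := fun p hp => aux_d_zero hVb hdδ hp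
  have hdd : ∀ p ∈ frontier Ω, DifferentiableAt ℝ d p := fun p hp => aux_diffAt hV hd (hVb hp)
  have hU := hdef.1
  have hcl := hdef.2.1
  have hρs : ContDiffOn ℝ (⊤ : ℕ∞) ρ U := hdef.2.2.1
  have hρd : ∀ p ∈ frontier Ω, DifferentiableAt ℝ ρ p :=
    fun p hp => aux_diffAt hU hρs (hcl hp.1)
  have hfd : ∀ p ∈ frontier Ω, fderiv ℝ d p ≠ 0 := by
    intro p hp h
    obtain ⟨l, hl, hl2⟩ := aux_first hΩo hdef hV hVb hd hdδ hp
    apply hdef.2.2.2.2 p hp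
    ext v
    have := hl2 v
    rw [h] at this
    simpa [hl.ne'] using this
  have hcz : ∀ p ∈ frontier Ω, cz n d p ≠ 0 := by
    intro p hp h
    apply hfd p hp
    have h1 : ∀ w, cGradPair n d p w = 0 := by
      intro w
      have : cGradPair n d p w = ∑ j, cz n d p j * w j := rfl
      rw [this, h]; simp
    ext v
    have := h1 v.ofLp
    rw [aux_cGradPair (hdd p hp)] at this
    have := congrArg Complex.re this
    simpa [vec] using this
  have hbase : ∀ p ∈ frontier Ω, ∀ w : Fin n → ℂ, w ≠ 0 → ∑ j, cz n d p j * w j = 0 →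
      0 < (cHessForm n (fun z => -d z) p w).re := by
    intro p hp w hw hw0
    obtain ⟨l, hl, hl2⟩ := aux_first hΩo hdef hV hVb hd hdδ hp
    have h1 : cGradPair n d p w = 0 := hw0
    rw [aux_cGradPair (hdd p hp)] at h1
    have hre := congrArg Complex.re h1
    have him := congrArg Complex.im h1
    simp at hre him
    rw [hl2] at hre him
    have e1 : fderiv ℝ ρ p (vec w) = 0 := by
      simpa [hl.ne'] using hre
    have e2 : fderiv ℝ ρ p (vec fun i => Complex.I * w i) = 0 := by
      simpa [hl.ne'] using him
    have h2 := hpc p hp w hw (by rw [aux_cGradPair (hρd p hp), e1, e2]; simp)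
    rw [aux_form hU hρs (hcl hp.1)] at h2
    have s1 := aux_second hΩo hdef hV hVb hd hdδ hp hl2 e1
    have s2 := aux_second hΩo hdef hV hVb hd hdδ hp hl2 e2
    have hn : ∀ v, D2 (fun z => -d z) p v v = -D2 d p v v := by
      intro v
      have : fderiv ℝ (fun z => -d z) = fun z => - fderiv ℝ d z := by
        funext z; exact fderiv_fun_neg
      simp only [D2, this, fderiv_fun_neg]
      rfl
    rw [aux_form hV hd.neg (hVb hp), hn, hn, s1, s2]
    have := mul_pos hl h2
    linarith
  obtain ⟨k, rfl⟩ : ∃ k, m = k + 1 := ⟨m - 1, by omega⟩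
  obtain ⟨W, a, E, hW, hWV, hΓW, ha, hE, hdet, -⟩ := aux_ind hV hVb hd hd0 hcz hbase k
  have hdW := hd.mono hWV
  set G : EC n → ℝ := fun z => ∑ j ∈ Finset.Icc 2 (k + 1), a j z * d z ^ (j - 1) with hG
  have hGs : ContDiffOn ℝ (⊤ : ℕ∞) G W := ContDiffOn.sum fun j _ => (ha j).mul (hdW.pow _)
  have hrG : ∀ z, ∑ j ∈ Finset.Icc 2 (k + 1), a j z * d z ^ j = d z * G z := by
    intro z
    rw [hG, Finset.mul_sum]
    refine Finset.sum_congr rfl fun j hj => ?_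
    have : j = (j - 1) + 1 := by have := (Finset.mem_Icc.mp hj).1; omega
    have h2 : d z ^ j = d z ^ (j - 1) * d z := by rw [← pow_succ, ← this]
    rw [h2]
    ring
  have hG0 : ∀ p ∈ frontier Ω, G p = 0 := by
    intro p hp
    refine Finset.sum_eq_zero fun j hj => ?_
    have := (Finset.mem_Icc.mp hj).1
    rw [hd0 p hp, zero_pow (by omega), mul_zero]
  set W1 := W ∩ G ⁻¹' Set.Iio 1 with hW1
  have hW1o : IsOpen W1 := hGs.continuousOn.isOpen_inter_preimage hW isOpen_Iio
  have hΓ1 : frontier Ω ⊆ W1 := fun p hp => ⟨hΓW hp, by simp [hG0 p hp]⟩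
  have hcomp : IsCompact (frontier Ω) :=
    Metric.isCompact_of_isClosed_isBounded isClosed_frontier
      (hΩb.closure.subset frontier_subset_closure)
  obtain ⟨K, hK, hΓK, hKW⟩ := exists_compact_between hcomp hW1o hΓ1
  obtain ⟨C, hC⟩ := hK.exists_bound_of_continuousOn
    (hE.continuousOn.mono (hKW.trans Set.inter_subset_left))
  have hKW' : interior K ⊆ W := (interior_subset.trans hKW).trans Set.inter_subset_left
  have hdpos : ∀ z ∈ interior K ∩ Ω, 0 < d z := by
    rintro z ⟨hzK, hzΩ⟩
    rw [hdδ z ⟨hWV (hKW' hzK), subset_closure hzΩ⟩]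
    refine (isClosed_frontier.notMem_iff_infDist_pos hne).mp ?_
    intro hz
    have := hz.2
    rw [hΩo.interior_eq] at this
    exact this hzΩ
  refine ⟨interior K, a, _, |C| + 1, isOpen_interior, hKW'.trans hWV, hΓK,
    fun j _ => (ha j).mono hKW', fun z => rfl, ?_, ?_, ?_, by positivity, ?_⟩
  · rintro z ⟨hzK, hzΩ⟩
    have h1 := hdpos z ⟨hzK, hzΩ⟩
    have h2 : G z < 1 := (hKW (interior_subset hzK)).2
    rw [hrG]
    nlinarith
  · intro p hp
    rw [hrG, hd0 p hp]; simp
  · intro p hp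
    have e : (fun z => -d z + ∑ k ∈ Finset.Icc 2 (k + 1), a k z * d z ^ k) =
        fun z => -d z + d z * G z := by
      funext z; rw [hrG]
    have hGd := aux_diffAt hW hGs (hΓW hp)
    rw [e, fderiv_fun_add (hdd p hp).fun_neg ((hdd p hp).fun_mul hGd),
      fderiv_fun_mul (hdd p hp) hGd, hd0 p hp, hG0 p hp, fderiv_fun_neg]
    simpa using hfd p hp
  · rintro z ⟨hzK, hzΩ⟩
    rw [hdet z (hKW' hzK), Complex.norm_real, norm_mul, norm_pow]
    rw [← hdδ z ⟨hWV (hKW' hzK), subset_closure hzΩ⟩]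
    have h1 := hdpos z ⟨hzK, hzΩ⟩
    have h2 := hC z (interior_subset hzK)
    rw [Real.norm_of_nonneg h1.le, mul_comm, Nat.add_sub_cancel]
    gcongr
    exact h2.trans ((le_abs_self C).trans (by linarith))
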